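/- arXiv:2506.01309 — 2 statements merged into one kernel-verified Lean document; each statement's English description precedes it below -/
import Mathlib

section
/- Let α̃₁, α̃₂, α̃₃ ∈ (0, 2π) \ {π} and suppose γ₂, γ₃ ∈ [−π, π] satisfy the three-fold compatibility condition R₂(γ₂) R₃(γ₃) t̃₄ = t̃₁. Then cos γ₂ = (−cos α̃₃ + cos α̃₁ cos α̃₂)/(sin α̃₁ sin α̃₂) and cos γ₃ = (−cos α̃₁ + cos α̃₂ cos α̃₃)/(sin α̃₂ sin α̃₃). -/
open Real

noncomputable section

/-- `ℝ³` as triples of reals. -/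
abbrev V3 : Type := Fin 3 → ℝ

/-- Euclidean dot product on `ℝ³`. -/
def dot3 (u v : V3) : ℝ := u 0 * v 0 + u 1 * v 1 + u 2 * v 2

/-- Cross product on `ℝ³`. -/
def cross3 (u v : V3) : V3 :=
  ![u 1 * v 2 - u 2 * v 1, u 2 * v 0 - u 0 * v 2, u 0 * v 1 - u 1 * v 0]

/-- Rotation of `ℝ³` about the unit axis `a` by angle `γ` (Rodrigues' formula,
right-hand rule). -/
def rot (a : V3) (γ : ℝ) (v : V3) : V3 :=
  Real.cos γ • v + Real.sin γ • cross3 a v + ((1 - Real.cos γ) * dot3 a v) • a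

/-- `R_{e₃}(φ) e₁ = (cos φ, sin φ, 0)`, the crease tangents of the intermediate state. -/
def tvec (φ : ℝ) : V3 := ![Real.cos φ, Real.sin φ, 0]

theorem dot3_tvec_self (φ : ℝ) : dot3 (tvec φ) (tvec φ) = 1 := by
  simp only [dot3, tvec, Matrix.cons_val]
  linear_combination Real.sin_sq_add_cos_sq φ

theorem dot3_rot_self {a : V3} (ha : dot3 a a = 1) (γ : ℝ) (v : V3) :
    dot3 a (rot a γ v) = dot3 a v := by
  simp only [dot3, rot, cross3, Pi.add_apply, Pi.smul_apply, smul_eq_mul, Matrix.cons_val] at ha ⊢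
  linear_combination (1 - Real.cos γ) * (a 0 * v 0 + a 1 * v 1 + a 2 * v 2) * ha

theorem rot_neg_rot {a : V3} (ha : dot3 a a = 1) (γ : ℝ) (v : V3) :
    rot a (-γ) (rot a γ v) = v := by
  have h := Real.sin_sq_add_cos_sq γ
  simp only [dot3] at ha
  ext i
  fin_cases i <;>
    simp only [dot3, rot, cross3, Pi.add_apply, Pi.smul_apply, smul_eq_mul, Matrix.cons_val,
      Real.cos_neg, Real.sin_neg, Fin.zero_eta, Fin.mk_one, Fin.reduceFinMk]
  · linear_combination v 0 * h + (Real.sin γ ^ 2 * v 0 +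
      (1 - Real.cos γ) ^ 2 * (a 0 * v 0 + a 1 * v 1 + a 2 * v 2) * a 0) * ha -
      (a 0 * v 0 + a 1 * v 1 + a 2 * v 2) * a 0 * h
  · linear_combination v 1 * h + (Real.sin γ ^ 2 * v 1 +
      (1 - Real.cos γ) ^ 2 * (a 0 * v 0 + a 1 * v 1 + a 2 * v 2) * a 1) * ha -
      (a 0 * v 0 + a 1 * v 1 + a 2 * v 2) * a 1 * h
  · linear_combination v 2 * h + (Real.sin γ ^ 2 * v 2 +
      (1 - Real.cos γ) ^ 2 * (a 0 * v 0 + a 1 * v 1 + a 2 * v 2) * a 2) * ha -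
      (a 0 * v 0 + a 1 * v 1 + a 2 * v 2) * a 2 * h

theorem dot3_tvec (φ ψ : ℝ) : dot3 (tvec φ) (tvec ψ) = Real.cos (φ - ψ) := by
  simp only [dot3, tvec, Matrix.cons_val, Real.cos_sub]
  ring

/-- The spherical law of cosines for coplanar crease tangents. -/
theorem dot3_tvec_rot_tvec (φ ψ χ γ : ℝ) :
    dot3 (tvec φ) (rot (tvec ψ) γ (tvec χ)) =
      Real.cos (φ - ψ) * Real.cos (ψ - χ) -
        Real.cos γ * (Real.sin (φ - ψ) * Real.sin (ψ - χ)) := by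
  have h : dot3 (tvec φ) (rot (tvec ψ) γ (tvec χ)) =
      Real.cos γ * dot3 (tvec φ) (tvec χ) +
        (1 - Real.cos γ) * dot3 (tvec ψ) (tvec χ) * dot3 (tvec φ) (tvec ψ) := by
    simp only [dot3, rot, cross3, tvec, Pi.add_apply, Pi.smul_apply, smul_eq_mul, Matrix.cons_val]
    ring
  rw [h, dot3_tvec, dot3_tvec, dot3_tvec, ← sub_add_sub_cancel φ ψ χ,
    Real.cos_add (φ - ψ) (ψ - χ)]
  ring

theorem sin_ne_zero_of_mem_Ioo_of_ne_pi {α : ℝ} (h : α ∈ Set.Ioo 0 (2 * π)) (h' : α ≠ π) :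
    Real.sin α ≠ 0 := by
  rcases lt_or_gt_of_ne h' with hlt | hgt
  · exact (Real.sin_pos_of_pos_of_lt_pi h.1 hlt).ne'
  · rw [← neg_ne_zero, ← Real.sin_sub_pi]
    exact (Real.sin_pos_of_pos_of_lt_pi (by linarith) (by linarith [h.2])).ne'

/-- If `γ₂, γ₃ ∈ [−π,π]` satisfy the three-fold compatibility condition
`R₂(γ₂)R₃(γ₃)t̃₄ = t̃₁`, then their cosines are given by the spherical-triangle formulas. -/
theorem threefold_cos_folding_angles (α₁ α₂ α₃ : ℝ)
    (h₁ : α₁ ∈ Set.Ioo 0 (2 * π)) (h₁' : α₁ ≠ π)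
    (h₂ : α₂ ∈ Set.Ioo 0 (2 * π)) (h₂' : α₂ ≠ π)
    (h₃ : α₃ ∈ Set.Ioo 0 (2 * π)) (h₃' : α₃ ≠ π)
    (γ₂ γ₃ : ℝ) (hγ₂ : γ₂ ∈ Set.Icc (-π) π) (hγ₃ : γ₃ ∈ Set.Icc (-π) π)
    (hcompat : rot (tvec α₁) γ₂ (rot (tvec (α₁ + α₂)) γ₃ (tvec (α₁ + α₂ + α₃))) = tvec 0) :
    Real.cos γ₂ =
        (-Real.cos α₃ + Real.cos α₁ * Real.cos α₂) / (Real.sin α₁ * Real.sin α₂) ∧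
      Real.cos γ₃ =
        (-Real.cos α₁ + Real.cos α₂ * Real.cos α₃) / (Real.sin α₂ * Real.sin α₃) := by
  have hs₁ := sin_ne_zero_of_mem_Ioo_of_ne_pi h₁ h₁'
  have hs₂ := sin_ne_zero_of_mem_Ioo_of_ne_pi h₂ h₂'
  have hs₃ := sin_ne_zero_of_mem_Ioo_of_ne_pi h₃ h₃'
  constructor
  · have h := rot_neg_rot (dot3_tvec_self α₁) γ₂
      (rot (tvec (α₁ + α₂)) γ₃ (tvec (α₁ + α₂ + α₃)))
    rw [hcompat] at h
    have key := dot3_tvec_rot_tvec (α₁ + α₂) α₁ 0 (-γ₂)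
    rw [h, dot3_rot_self (dot3_tvec_self _), dot3_tvec, sub_add_cancel_left, Real.cos_neg,
      Real.cos_neg, add_sub_cancel_left, sub_zero] at key
    rw [eq_div_iff (mul_ne_zero hs₁ hs₂)]
    linear_combination key
  · have h := dot3_rot_self (dot3_tvec_self α₁) γ₂
      (rot (tvec (α₁ + α₂)) γ₃ (tvec (α₁ + α₂ + α₃)))
    rw [hcompat, dot3_tvec, dot3_tvec_rot_tvec, sub_zero, sub_add_cancel_left,
      sub_add_cancel_left, Real.cos_neg, Real.cos_neg, Real.sin_neg, Real.sin_neg] at h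
    rw [eq_div_iff (mul_ne_zero hs₂ hs₃)]
    linear_combination h
end
end

section
/- Let α̃₁, α̃₂, α̃₃ ∈ (0, 2π) \ {π} and suppose γ₂, γ₃ ∈ [−π, π] satisfy the three-fold compatibility condition R₂(γ₂) R₃(γ₃) t̃₄ = t̃₁. Then sin α̃₃ · sin γ₃ = sin α̃₁ · sin γ₂. -/
open Real

noncomputable section

theorem rot_tvec_apply_two (φ γ : ℝ) (v : V3) :
    rot (tvec φ) γ v 2 =
      Real.cos γ * v 2 + Real.sin γ * (Real.cos φ * v 1 - Real.sin φ * v 0) := by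
  simp only [rot, cross3, dot3, tvec, Matrix.cons_val, Pi.add_apply, Pi.smul_apply, smul_eq_mul]
  ring

theorem rot_tvec_tvec_apply_two (φ ψ γ : ℝ) :
    rot (tvec φ) γ (tvec (φ + ψ)) 2 = Real.sin ψ * Real.sin γ := by
  rw [rot_tvec_apply_two]
  simp only [tvec, Real.cos_add, Real.sin_add, Matrix.cons_val]
  linear_combination (Real.sin γ * Real.sin ψ) * Real.sin_sq_add_cos_sq φ

theorem rot_neg_rot_tvec_apply_two (φ γ : ℝ) (v : V3) :
    rot (tvec φ) (-γ) (rot (tvec φ) γ v) 2 = v 2 := by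
  rw [rot_tvec_apply_two]
  simp only [rot, cross3, dot3, tvec, Matrix.cons_val, Pi.add_apply, Pi.smul_apply, smul_eq_mul,
    Real.cos_neg, Real.sin_neg]
  linear_combination (v 2 * Real.sin γ ^ 2) * Real.sin_sq_add_cos_sq φ +
    v 2 * Real.sin_sq_add_cos_sq γ

/-- If `γ₂, γ₃ ∈ [−π,π]` satisfy the three-fold compatibility condition
`R₂(γ₂)R₃(γ₃)t̃₄ = t̃₁`, then `sin α̃₃ sin γ₃ = sin α̃₁ sin γ₂`. -/
theorem threefold_sin_relation (α₁ α₂ α₃ : ℝ)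
    (h₁ : α₁ ∈ Set.Ioo 0 (2 * π)) (h₁' : α₁ ≠ π)
    (h₂ : α₂ ∈ Set.Ioo 0 (2 * π)) (h₂' : α₂ ≠ π)
    (h₃ : α₃ ∈ Set.Ioo 0 (2 * π)) (h₃' : α₃ ≠ π)
    (γ₂ γ₃ : ℝ) (hγ₂ : γ₂ ∈ Set.Icc (-π) π) (hγ₃ : γ₃ ∈ Set.Icc (-π) π)
    (hcompat : rot (tvec α₁) γ₂ (rot (tvec (α₁ + α₂)) γ₃ (tvec (α₁ + α₂ + α₃))) = tvec 0) :
    Real.sin α₃ * Real.sin γ₃ = Real.sin α₁ * Real.sin γ₂ := by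
  have h := rot_neg_rot_tvec_apply_two α₁ γ₂
    (rot (tvec (α₁ + α₂)) γ₃ (tvec (α₁ + α₂ + α₃)))
  rw [hcompat, rot_tvec_tvec_apply_two, rot_tvec_apply_two] at h
  simp [tvec] at h
  linarith
end
end
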